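/- arXiv:1703.05133 — 2 statements merged into one kernel-verified Lean document; each statement's English description precedes it below -/
import Mathlib

section
/- Let Φ be the standard Spin(7) 4-form on R⁸. Then the linear map B: Λ²(R⁸)* → Λ²(R⁸)*, B(α) = ∗(Φ ∧ α), satisfies (B − 3)(B + 1) = 0, and Λ²(R⁸)* decomposes into the eigenspace Λ²₇ = {α : Φ ∧ α = 3∗α} of dimension 7 and the eigenspace Λ²₂₁ = {α : Φ ∧ α = −∗α} of dimension 21. -/
open ExteriorAlgebra

noncomputable section

abbrev W8 := Fin 8 → ℝ
abbrev E8 := ExteriorAlgebra ℝ W8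

/-- The standard basis covectors `e^μ`, `μ = 0,…,7`. -/
def e8 (i : Fin 8) : E8 := ExteriorAlgebra.ι ℝ (Pi.single i 1)

/-- The wedge monomial `e^{μ₁…μ_k}` for `{μ₁ < ⋯ < μ_k} = s`. -/
def mono8 (s : Finset (Fin 8)) : E8 := ((s.sort (· ≤ ·)).map e8).prod

/-- The standard volume form `e^{0…7}`. -/
def vol8 : E8 := mono8 Finset.univ

/-- The space of `k`-forms. -/
def gr8 (k : ℕ) : Submodule ℝ E8 := ⋀[ℝ]^k W8

/-- The standard Spin(7) 4-form
`Φ = e^{0123}+e^{0145}+e^{0167}+e^{0246}−e^{0257}−e^{0347}−e^{0356}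
 +e^{4567}+e^{2367}+e^{2345}+e^{1357}−e^{1346}−e^{1256}−e^{1247}`. -/
def Phi8 : E8 :=
  e8 0 * e8 1 * e8 2 * e8 3 + e8 0 * e8 1 * e8 4 * e8 5 + e8 0 * e8 1 * e8 6 * e8 7
    + e8 0 * e8 2 * e8 4 * e8 6 - e8 0 * e8 2 * e8 5 * e8 7 - e8 0 * e8 3 * e8 4 * e8 7
    - e8 0 * e8 3 * e8 5 * e8 6
    + e8 4 * e8 5 * e8 6 * e8 7 + e8 2 * e8 3 * e8 6 * e8 7 + e8 2 * e8 3 * e8 4 * e8 5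
    + e8 1 * e8 3 * e8 5 * e8 7 - e8 1 * e8 3 * e8 4 * e8 6 - e8 1 * e8 2 * e8 5 * e8 6
    - e8 1 * e8 2 * e8 4 * e8 7

/-- The map `B(α) = ∗(Φ ∧ α)`. -/
def B8 (st : E8 →ₗ[ℝ] E8) : E8 →ₗ[ℝ] E8 := st ∘ₗ LinearMap.mulLeft ℝ Phi8

/-- The eigenspace `Λ²₇ = {α ∈ Λ² : Φ ∧ α = 3 ∗α}`. -/
def L87 (st : E8 →ₗ[ℝ] E8) : Submodule ℝ E8 :=
  gr8 2 ⊓ LinearMap.ker (LinearMap.mulLeft ℝ Phi8 - (3 : ℝ) • st)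

/-- The eigenspace `Λ²₂₁ = {α ∈ Λ² : Φ ∧ α = −∗α}`. -/
def L821 (st : E8 →ₗ[ℝ] E8) : Submodule ℝ E8 :=
  gr8 2 ⊓ LinearMap.ker (LinearMap.mulLeft ℝ Phi8 + st)

/-- The wedge word `e^{l₁} ∧ ⋯ ∧ e^{l_k}` of an arbitrary list of indices. -/
def word8 (l : List (Fin 8)) : E8 := (l.map e8).prod

lemma word8_append (l m : List (Fin 8)) : word8 (l ++ m) = word8 l * word8 m := by
  simp [word8]

lemma word8_cons (i : Fin 8) (l : List (Fin 8)) : word8 (i :: l) = e8 i * word8 l := by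
  simp [word8]

lemma e8_mul_self (i : Fin 8) : e8 i * e8 i = 0 := ι_sq_zero _

lemma e8_mul_swap (i j : Fin 8) : e8 i * e8 j = -(e8 j * e8 i) :=
  eq_neg_of_add_eq_zero_left (ι_add_mul_swap _ _)

/-- Insertion of an index into an increasing list of indices, together with the sign picked up by
the wedge word; the sign is `0` if the index already occurs. -/
def signedInsert (i : Fin 8) : List (Fin 8) → ℤ × List (Fin 8)
  | [] => (1, [i])
  | j :: l =>
    if i < j then (1, i :: j :: l)
    else if i = j then (0, [])
    else (-(signedInsert i l).1, j :: (signedInsert i l).2)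

lemma e8_mul_word8 (i : Fin 8) (l : List (Fin 8)) :
    e8 i * word8 l = (signedInsert i l).1 • word8 (signedInsert i l).2 := by
  induction l with
  | nil => simp [signedInsert, word8]
  | cons j l ih =>
    unfold signedInsert
    split_ifs with h₁ h₂
    · simp [word8_cons]
    · subst h₂
      rw [word8_cons, ← mul_assoc, e8_mul_self]
      simp
    · rw [word8_cons, ← mul_assoc, e8_mul_swap i j, neg_mul, mul_assoc, ih, mul_smul_comm,
        word8_cons, neg_smul]

/-- The sign and the increasing list obtained by sorting a list of indices. -/
def signedSort : List (Fin 8) → ℤ × List (Fin 8)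
  | [] => (1, [])
  | i :: l =>
    ((signedSort l).1 * (signedInsert i (signedSort l).2).1,
      (signedInsert i (signedSort l).2).2)

lemma word8_eq_signedSort (l : List (Fin 8)) :
    word8 l = (signedSort l).1 • word8 (signedSort l).2 := by
  induction l with
  | nil => simp [signedSort]
  | cons i l ih =>
    rw [word8_cons, ih, mul_smul_comm, e8_mul_word8, smul_smul]
    rfl

lemma sort_toFinset_of_pairwise_lt {l : List (Fin 8)} (hl : l.Pairwise (· < ·)) :
    l.toFinset.sort (· ≤ ·) = l :=
  (List.toFinset_sort (· ≤ ·) (hl.imp ne_of_lt)).2 (hl.imp le_of_lt)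

lemma word8_eq_mono8 {l : List (Fin 8)} (hl : l.Pairwise (· < ·)) :
    word8 l = mono8 l.toFinset := by
  rw [mono8, sort_toFinset_of_pairwise_lt hl, word8]

lemma mul_mem_gr8 {k l : ℕ} {α β : E8} (hα : α ∈ gr8 k) (hβ : β ∈ gr8 l) :
    α * β ∈ gr8 (k + l) := by
  rw [gr8, exteriorPower, pow_add]
  exact Submodule.mul_mem_mul hα hβ

lemma e8_mem_gr8 (i : Fin 8) : e8 i ∈ gr8 1 := by
  rw [gr8, exteriorPower, pow_one]
  exact LinearMap.mem_range_self _ _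

lemma word8_mem_gr8 (l : List (Fin 8)) : word8 l ∈ gr8 l.length := by
  induction l with
  | nil => exact Submodule.one_le.1 (pow_zero _).ge
  | cons i l ih =>
    rw [word8_cons, List.length_cons, add_comm]
    exact mul_mem_gr8 (e8_mem_gr8 i) ih

/-- The coefficient of a wedge word of length eight with respect to the volume form. -/
def volCoeff (l : List (Fin 8)) : ℤ :=
  if (signedSort l).2 = [0, 1, 2, 3, 4, 5, 6, 7] then (signedSort l).1 else 0

lemma word8_eq_volCoeff {l : List (Fin 8)}
    (hl : (signedSort l).1 = 0 ∨ (signedSort l).2 = [0, 1, 2, 3, 4, 5, 6, 7]) :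
    word8 l = volCoeff l • vol8 := by
  have hvol : vol8 = word8 [0, 1, 2, 3, 4, 5, 6, 7] := by
    rw [word8_eq_mono8 (by decide), vol8]
    congr 1
  rw [word8_eq_signedSort, volCoeff, hvol]
  split_ifs with h
  · rw [h]
  · simp [hl.resolve_right h]

/-- Seven quadruples of oriented pairs of indices. Each quadruple partitions the eight indices
positively, and the products of two distinct pairs of a quadruple are the terms of `Φ`. -/
def pairIndex : Fin 7 → Fin 4 → List (Fin 8) :=
  ![![[0, 1], [2, 3], [4, 5], [6, 7]],
    ![[0, 2], [3, 1], [4, 6], [7, 5]],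
    ![[0, 3], [1, 2], [7, 4], [6, 5]],
    ![[0, 4], [5, 1], [6, 2], [3, 7]],
    ![[0, 5], [1, 4], [2, 7], [3, 6]],
    ![[0, 6], [7, 1], [2, 4], [5, 3]],
    ![[0, 7], [1, 6], [5, 2], [4, 3]]]

/-- The three other pairs of the quadruple of a given pair, concatenated. -/
def coPairIndex (i : Fin 7) (a : Fin 4) : List (Fin 8) :=
  pairIndex i (a + 1) ++ pairIndex i (a + 2) ++ pairIndex i (a + 3)

/-- The terms of `Φ`, as signed lists of indices. -/
def phiTerms : List (ℤ × List (Fin 8)) :=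
  [(1, [0, 1, 2, 3]), (1, [0, 1, 4, 5]), (1, [0, 1, 6, 7]), (1, [0, 2, 4, 6]),
    (-1, [0, 2, 5, 7]), (-1, [0, 3, 4, 7]), (-1, [0, 3, 5, 6]), (1, [4, 5, 6, 7]),
    (1, [2, 3, 6, 7]), (1, [2, 3, 4, 5]), (1, [1, 3, 5, 7]), (-1, [1, 3, 4, 6]),
    (-1, [1, 2, 5, 6]), (-1, [1, 2, 4, 7])]

lemma Phi8_eq_sum : Phi8 = (phiTerms.map fun p => p.1 • word8 p.2).sum := by
  simp only [Phi8, phiTerms, word8, List.map_cons, List.map_nil, List.sum_cons, List.sum_nil,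
    List.prod_cons, List.prod_nil, mul_one, one_smul, neg_smul, mul_assoc]
  abel

lemma Phi8_mem_gr8 : Phi8 ∈ gr8 4 := by
  rw [Phi8_eq_sum]
  refine list_sum_mem fun α hα => ?_
  obtain ⟨p, hp, rfl⟩ := List.mem_map.1 hα
  have h : ∀ p ∈ phiTerms, p.2.length = 4 := by decide
  exact zsmul_mem (h p hp ▸ word8_mem_gr8 p.2) _

lemma Phi8_mul_word8 {l : List (Fin 8)}
    (hl : ∀ p ∈ phiTerms, (signedSort (p.2 ++ l)).1 = 0 ∨
      (signedSort (p.2 ++ l)).2 = [0, 1, 2, 3, 4, 5, 6, 7]) :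
    Phi8 * word8 l = (phiTerms.map fun p => p.1 * volCoeff (p.2 ++ l)).sum • vol8 := by
  rw [Phi8_eq_sum]
  generalize phiTerms = L at hl
  induction L with
  | nil => simp
  | cons p L ih =>
    simp only [List.map_cons, List.sum_cons, add_mul, add_smul]
    rw [ih fun q hq => hl q (List.mem_cons_of_mem _ hq), smul_mul_assoc, ← word8_append,
      word8_eq_volCoeff (hl p List.mem_cons_self), smul_smul]

lemma signedSort_phi_pair_pair : ∀ (i : Fin 7) (a : Fin 4) (j : Fin 7) (b : Fin 4),
    (∀ p ∈ phiTerms, (signedSort (p.2 ++ (pairIndex i a ++ pairIndex j b))).1 = 0 ∨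
      (signedSort (p.2 ++ (pairIndex i a ++ pairIndex j b))).2 = [0, 1, 2, 3, 4, 5, 6, 7]) ∧
    (phiTerms.map fun p => p.1 * volCoeff (p.2 ++ (pairIndex i a ++ pairIndex j b))).sum =
      if i = j ∧ a ≠ b then 1 else 0 := by
  decide +kernel

/-- The two-forms of the pairs. -/
def pairForm (x : Fin 7 × Fin 4) : E8 := word8 (pairIndex x.1 x.2)

/-- The six-forms complementary to the pairs. -/
def coPairForm (x : Fin 7 × Fin 4) : E8 := word8 (coPairIndex x.1 x.2)

lemma pairForm_mem (x : Fin 7 × Fin 4) : pairForm x ∈ gr8 2 := by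
  have h : ∀ (i : Fin 7) (a : Fin 4), (pairIndex i a).length = 2 := by decide
  exact h x.1 x.2 ▸ word8_mem_gr8 (pairIndex x.1 x.2)

lemma coPairForm_mem (x : Fin 7 × Fin 4) : coPairForm x ∈ gr8 6 := by
  have h : ∀ (i : Fin 7) (a : Fin 4), (coPairIndex i a).length = 6 := by decide
  exact h x.1 x.2 ▸ word8_mem_gr8 (coPairIndex x.1 x.2)

lemma Phi8_mul_pairForm_mul_pairForm (x y : Fin 7 × Fin 4) :
    Phi8 * pairForm x * pairForm y = if x.1 = y.1 ∧ x.2 ≠ y.2 then vol8 else 0 := by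
  obtain ⟨h₁, h₂⟩ := signedSort_phi_pair_pair x.1 x.2 y.1 y.2
  rw [mul_assoc, pairForm, pairForm, ← word8_append, Phi8_mul_word8 h₁, h₂]
  split_ifs <;> simp

lemma pairForm_mul_coPairForm (x y : Fin 7 × Fin 4) :
    pairForm x * coPairForm y = if x = y then vol8 else 0 := by
  have h : ∀ (i : Fin 7) (a : Fin 4) (j : Fin 7) (b : Fin 4),
      ((signedSort (pairIndex i a ++ coPairIndex j b)).1 = 0 ∨
        (signedSort (pairIndex i a ++ coPairIndex j b)).2 = [0, 1, 2, 3, 4, 5, 6, 7]) ∧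
      volCoeff (pairIndex i a ++ coPairIndex j b) = if i = j ∧ a = b then 1 else 0 := by
    decide +kernel
  obtain ⟨h₁, h₂⟩ := h x.1 x.2 y.1 y.2
  rw [pairForm, coPairForm, ← word8_append, word8_eq_volCoeff h₁, h₂]
  simp only [Prod.ext_iff]
  split_ifs <;> simp

lemma coPairForm_mul_pairForm (x y : Fin 7 × Fin 4) :
    coPairForm x * pairForm y = if x = y then vol8 else 0 := by
  have h : ∀ (i : Fin 7) (a : Fin 4) (j : Fin 7) (b : Fin 4),
      ((signedSort (coPairIndex i a ++ pairIndex j b)).1 = 0 ∨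
        (signedSort (coPairIndex i a ++ pairIndex j b)).2 = [0, 1, 2, 3, 4, 5, 6, 7]) ∧
      volCoeff (coPairIndex i a ++ pairIndex j b) = if i = j ∧ a = b then 1 else 0 := by
    decide +kernel
  obtain ⟨h₁, h₂⟩ := h x.1 x.2 y.1 y.2
  rw [pairForm, coPairForm, ← word8_append, word8_eq_volCoeff h₁, h₂]
  simp only [Prod.ext_iff]
  split_ifs <;> simp

lemma finrank_gr8 (k : ℕ) : Module.finrank ℝ (gr8 k) = Nat.choose 8 k := by
  rw [gr8, exteriorPower.finrank_eq, Module.finrank_fin_fun]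

instance (k : ℕ) : FiniteDimensional ℝ (gr8 k) :=
  inferInstanceAs (FiniteDimensional ℝ (⋀[ℝ]^k W8))

section Metric

variable {gE : E8 →ₗ[ℝ] E8 →ₗ[ℝ] ℝ}

lemma gram_word8 (hg : ∀ s t : Finset (Fin 8), gE (mono8 s) (mono8 t) = if s = t then 1 else 0)
    {l m : List (Fin 8)} (hl : (signedSort l).2.Pairwise (· < ·))
    (hm : (signedSort m).2.Pairwise (· < ·)) :
    gE (word8 l) (word8 m) = ((if (signedSort l).2 = (signedSort m).2 then
      (signedSort l).1 * (signedSort m).1 else 0 : ℤ) : ℝ) := by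
  have hiff : (signedSort l).2.toFinset = (signedSort m).2.toFinset ↔
      (signedSort l).2 = (signedSort m).2 := by
    refine ⟨fun h => ?_, fun h => by rw [h]⟩
    rw [← sort_toFinset_of_pairwise_lt hl, h, sort_toFinset_of_pairwise_lt hm]
  rw [word8_eq_signedSort l, word8_eq_signedSort m, word8_eq_mono8 hl, word8_eq_mono8 hm,
    map_zsmul, map_zsmul, LinearMap.smul_apply, hg]
  simp only [hiff]
  split_ifs <;> simp [mul_comm]

lemma gram_pairForm
    (hg : ∀ s t : Finset (Fin 8), gE (mono8 s) (mono8 t) = if s = t then 1 else 0)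
    (x y : Fin 7 × Fin 4) : gE (pairForm x) (pairForm y) = if x = y then 1 else 0 := by
  have hs : ∀ (i : Fin 7) (a : Fin 4), (signedSort (pairIndex i a)).2.Pairwise (· < ·) := by
    decide +kernel
  have h : ∀ (i : Fin 7) (a : Fin 4) (j : Fin 7) (b : Fin 4),
      (if (signedSort (pairIndex i a)).2 = (signedSort (pairIndex j b)).2 then
        (signedSort (pairIndex i a)).1 * (signedSort (pairIndex j b)).1 else 0) =
      if i = j ∧ a = b then 1 else 0 := by
    decide +kernel
  rw [pairForm, pairForm, gram_word8 hg (hs _ _) (hs _ _), h]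
  simp only [Prod.ext_iff]
  split_ifs <;> simp

lemma gram_coPairForm
    (hg : ∀ s t : Finset (Fin 8), gE (mono8 s) (mono8 t) = if s = t then 1 else 0)
    (x y : Fin 7 × Fin 4) : gE (coPairForm x) (coPairForm y) = if x = y then 1 else 0 := by
  have hs : ∀ (i : Fin 7) (a : Fin 4), (signedSort (coPairIndex i a)).2.Pairwise (· < ·) := by
    decide +kernel
  have h : ∀ (i : Fin 7) (a : Fin 4) (j : Fin 7) (b : Fin 4),
      (if (signedSort (coPairIndex i a)).2 = (signedSort (coPairIndex j b)).2 then
        (signedSort (coPairIndex i a)).1 * (signedSort (coPairIndex j b)).1 else 0) =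
      if i = j ∧ a = b then 1 else 0 := by
    decide +kernel
  rw [coPairForm, coPairForm, gram_word8 hg (hs _ _) (hs _ _), h]
  simp only [Prod.ext_iff]
  split_ifs <;> simp

end Metric

section Bilinear

variable {E κ : Type*} [AddCommGroup E] [Module ℝ E] [Fintype κ] [DecidableEq κ]
  {g : E →ₗ[ℝ] E →ₗ[ℝ] ℝ}

lemma linearIndependent_of_dual {u v : κ → E}
    (h : ∀ i j, g (u i) (v j) = if i = j then 1 else 0) : LinearIndependent ℝ u := by
  rw [Fintype.linearIndependent_iff]
  intro c hc j
  simpa [h] using congrArg (fun w => g w (v j)) hc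

lemma span_range_eq_of_orthonormal {V : Submodule ℝ E} {v : κ → E} (hv : ∀ i, v i ∈ V)
    (hcard : Module.finrank ℝ V = Fintype.card κ) [FiniteDimensional ℝ V]
    (h : ∀ i j, g (v i) (v j) = if i = j then 1 else 0) :
    Submodule.span ℝ (Set.range v) = V := by
  refine Submodule.eq_of_le_of_finrank_eq (Submodule.span_le.2 (Set.range_subset_iff.2 hv)) ?_
  rw [finrank_span_eq_card (linearIndependent_of_dual h), hcard]

lemma eq_sum_of_orthonormal {v : κ → E}
    (h : ∀ i j, g (v i) (v j) = if i = j then 1 else 0) {w : E}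
    (hw : w ∈ Submodule.span ℝ (Set.range v)) : w = ∑ i, g w (v i) • v i := by
  obtain ⟨c, rfl⟩ := (Submodule.mem_span_range_iff_exists_fun ℝ).1 hw
  simp [h]

end Bilinear

section Star

variable {gE : E8 →ₗ[ℝ] E8 →ₗ[ℝ] ℝ} {st : E8 →ₗ[ℝ] E8}

lemma vol8_ne_zero
    (hg : ∀ s t : Finset (Fin 8), gE (mono8 s) (mono8 t) = if s = t then 1 else 0) :
    vol8 ≠ 0 := by
  intro h
  have := hg Finset.univ Finset.univ
  rw [← vol8, h] at this
  simp at this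

lemma span_pairForm
    (hg : ∀ s t : Finset (Fin 8), gE (mono8 s) (mono8 t) = if s = t then 1 else 0) :
    Submodule.span ℝ (Set.range pairForm) = gr8 2 :=
  span_range_eq_of_orthonormal pairForm_mem (by rw [finrank_gr8]; rfl) (gram_pairForm hg)

lemma span_coPairForm
    (hg : ∀ s t : Finset (Fin 8), gE (mono8 s) (mono8 t) = if s = t then 1 else 0) :
    Submodule.span ℝ (Set.range coPairForm) = gr8 6 :=
  span_range_eq_of_orthonormal coPairForm_mem (by rw [finrank_gr8]; rfl) (gram_coPairForm hg)

/-- The Hodge star of `α` pairs with a complementary form `β` by the coefficient of `α ∧ β`. -/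
lemma inner_star_eq
    (hg : ∀ s t : Finset (Fin 8), gE (mono8 s) (mono8 t) = if s = t then 1 else 0)
    (hst : ∀ (k : ℕ), ∀ α ∈ gr8 k, ∀ β ∈ gr8 (8 - k), α * β = gE (st α) β • vol8)
    (k : ℕ) {α β : E8} (hα : α ∈ gr8 k) (hβ : β ∈ gr8 (8 - k)) {p : Prop} [Decidable p]
    (h : α * β = if p then vol8 else 0) : gE (st α) β = if p then 1 else 0 := by
  refine smul_left_injective ℝ (vol8_ne_zero hg) ?_
  simp only [← hst k α hα β hβ, h]
  split_ifs <;> simp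

lemma star_pairForm
    (hg : ∀ s t : Finset (Fin 8), gE (mono8 s) (mono8 t) = if s = t then 1 else 0)
    (hst_deg : ∀ k : ℕ, ∀ α ∈ gr8 k, st α ∈ gr8 (8 - k))
    (hst : ∀ (k : ℕ), ∀ α ∈ gr8 k, ∀ β ∈ gr8 (8 - k), α * β = gE (st α) β • vol8)
    (x : Fin 7 × Fin 4) : st (pairForm x) = coPairForm x := by
  have hmem : st (pairForm x) ∈ Submodule.span ℝ (Set.range coPairForm) := by
    rw [span_coPairForm hg]
    exact hst_deg 2 _ (pairForm_mem x)
  rw [eq_sum_of_orthonormal (gram_coPairForm hg) hmem]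
  simp [fun y => inner_star_eq hg hst 2 (pairForm_mem x) (coPairForm_mem y)
    (pairForm_mul_coPairForm x y)]

lemma star_coPairForm
    (hg : ∀ s t : Finset (Fin 8), gE (mono8 s) (mono8 t) = if s = t then 1 else 0)
    (hst_deg : ∀ k : ℕ, ∀ α ∈ gr8 k, st α ∈ gr8 (8 - k))
    (hst : ∀ (k : ℕ), ∀ α ∈ gr8 k, ∀ β ∈ gr8 (8 - k), α * β = gE (st α) β • vol8)
    (x : Fin 7 × Fin 4) : st (coPairForm x) = pairForm x := by
  have hmem : st (coPairForm x) ∈ Submodule.span ℝ (Set.range pairForm) := by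
    rw [span_pairForm hg]
    exact hst_deg 6 _ (coPairForm_mem x)
  rw [eq_sum_of_orthonormal (gram_pairForm hg) hmem]
  simp [fun y => inner_star_eq hg hst 6 (coPairForm_mem x) (pairForm_mem y)
    (coPairForm_mul_pairForm x y)]

/-- The sum of the two-forms of a quadruple of pairs. -/
def quadForm (i : Fin 7) : E8 := ∑ a, pairForm (i, a)

lemma B8_pairForm
    (hg : ∀ s t : Finset (Fin 8), gE (mono8 s) (mono8 t) = if s = t then 1 else 0)
    (hst_deg : ∀ k : ℕ, ∀ α ∈ gr8 k, st α ∈ gr8 (8 - k))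
    (hst : ∀ (k : ℕ), ∀ α ∈ gr8 k, ∀ β ∈ gr8 (8 - k), α * β = gE (st α) β • vol8)
    (x : Fin 7 × Fin 4) : B8 st (pairForm x) = quadForm x.1 - pairForm x := by
  have hPhi : Phi8 * pairForm x ∈ gr8 6 := mul_mem_gr8 Phi8_mem_gr8 (pairForm_mem x)
  have hmem : st (Phi8 * pairForm x) ∈ Submodule.span ℝ (Set.range pairForm) := by
    rw [span_pairForm hg]
    exact hst_deg 6 _ hPhi
  have hcoef (y : Fin 7 × Fin 4) : gE (st (Phi8 * pairForm x)) (pairForm y) =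
      (if x.1 = y.1 then 1 else 0) - if x = y then 1 else 0 := by
    rw [inner_star_eq hg hst 6 hPhi (pairForm_mem y) (Phi8_mul_pairForm_mul_pairForm x y)]
    by_cases h₁ : x.1 = y.1 <;> by_cases h₂ : x.2 = y.2 <;> simp [h₁, h₂, Prod.ext_iff]
  change st (Phi8 * pairForm x) = _
  rw [eq_sum_of_orthonormal (gram_pairForm hg) hmem]
  simp only [hcoef, sub_smul, Finset.sum_sub_distrib]
  simp [Fintype.sum_prod_type_right, quadForm]

lemma B8_quadForm
    (hB : ∀ x, B8 st (pairForm x) = quadForm x.1 - pairForm x) (i : Fin 7) :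
    B8 st (quadForm i) = (3 : ℝ) • quadForm i := by
  conv_lhs => rw [quadForm, map_sum]
  simp only [hB, Finset.sum_sub_distrib, Finset.sum_const, Finset.card_univ, Fintype.card_fin]
  rw [← quadForm]
  module

lemma quadForm_linearIndependent
    (hg : ∀ s t : Finset (Fin 8), gE (mono8 s) (mono8 t) = if s = t then 1 else 0) :
    LinearIndependent ℝ quadForm := by
  refine linearIndependent_of_dual (g := gE) (v := fun j => pairForm (j, 0)) fun i j => ?_
  simp only [quadForm, map_sum, LinearMap.sum_apply, gram_pairForm hg, Prod.mk.injEq]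
  by_cases h : i = j <;> simp [h]

end Star

/-- `(B − 3)(B + 1) = 0` on `Λ²`, and `Λ²` decomposes into the
eigenspaces `Λ²₇` (dimension 7) and `Λ²₂₁` (dimension 21). -/
theorem stmt9
    (gE : E8 →ₗ[ℝ] E8 →ₗ[ℝ] ℝ)
    (hg : ∀ s t : Finset (Fin 8), gE (mono8 s) (mono8 t) = if s = t then 1 else 0)
    (st : E8 →ₗ[ℝ] E8)
    (hst_deg : ∀ k : ℕ, ∀ α ∈ gr8 k, st α ∈ gr8 (8 - k))
    (hst : ∀ (k : ℕ), ∀ α ∈ gr8 k, ∀ β ∈ gr8 (8 - k), α * β = gE (st α) β • vol8)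
    :
    (∀ α ∈ gr8 2, B8 st (B8 st α) - (2 : ℝ) • B8 st α - (3 : ℝ) • α = 0) ∧
    L87 st ⊓ L821 st = ⊥ ∧
    L87 st ⊔ L821 st = gr8 2 ∧
    Module.finrank ℝ (L87 st) = 7 ∧
    Module.finrank ℝ (L821 st) = 21 := by
  have hB := B8_pairForm hg hst_deg hst
  have hspan := span_pairForm hg
  have hstst : ∀ α ∈ gr8 2, st (st α) = α := by
    intro α hα
    refine LinearMap.eqOn_span' (f := st ∘ₗ st) (g := LinearMap.id) ?_ (hspan.symm ▸ hα)
    rintro _ ⟨x, rfl⟩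
    simp [star_pairForm hg hst_deg hst, star_coPairForm hg hst_deg hst]
  have hstst' : ∀ α ∈ gr8 6, st (st α) = α := by
    intro α hα
    refine LinearMap.eqOn_span' (f := st ∘ₗ st) (g := LinearMap.id) ?_ (span_coPairForm hg ▸ hα)
    rintro _ ⟨x, rfl⟩
    simp [star_pairForm hg hst_deg hst, star_coPairForm hg hst_deg hst]
  have hPhi : ∀ α ∈ gr8 2, Phi8 * α ∈ gr8 6 := fun α hα => mul_mem_gr8 Phi8_mem_gr8 hα
  have hBmem : ∀ α ∈ gr8 2, B8 st α ∈ gr8 2 := fun α hα => hst_deg 6 _ (hPhi α hα)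
  have hmul : ∀ α ∈ gr8 2, Phi8 * α = st (B8 st α) := fun α hα => (hstst' _ (hPhi α hα)).symm
  have hquad : ∀ α ∈ gr8 2, B8 st (B8 st α) - (2 : ℝ) • B8 st α - (3 : ℝ) • α = 0 := by
    intro α hα
    refine LinearMap.eqOn_span' (g := (0 : E8 →ₗ[ℝ] E8))
      (f := B8 st ∘ₗ B8 st - (2 : ℝ) • B8 st - (3 : ℝ) • LinearMap.id) ?_ (hspan.symm ▸ hα)
    rintro _ ⟨x, rfl⟩
    simp only [LinearMap.sub_apply, LinearMap.comp_apply, LinearMap.smul_apply, LinearMap.id_apply,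
      LinearMap.zero_apply, hB, map_sub, B8_quadForm hB]
    module
  have hmem₇ : ∀ α, α ∈ L87 st ↔ α ∈ gr8 2 ∧ B8 st α = (3 : ℝ) • α := by
    intro α
    refine and_congr_right fun hα => ?_
    rw [SetLike.mem_coe, LinearMap.mem_ker, LinearMap.sub_apply, LinearMap.mulLeft_apply,
      LinearMap.smul_apply, sub_eq_zero]
    refine ⟨fun h => ?_, fun h => by rw [hmul α hα, h, map_smul]⟩
    change st (Phi8 * α) = _
    rw [h, map_smul, hstst α hα]
  have hmem₂₁ : ∀ α, α ∈ L821 st ↔ α ∈ gr8 2 ∧ B8 st α = -α := by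
    intro α
    refine and_congr_right fun hα => ?_
    rw [SetLike.mem_coe, LinearMap.mem_ker, LinearMap.add_apply, LinearMap.mulLeft_apply,
      add_eq_zero_iff_eq_neg]
    refine ⟨fun h => ?_, fun h => by rw [hmul α hα, h, map_neg]⟩
    change st (Phi8 * α) = _
    rw [h, map_neg, hstst α hα]
  have hinf : L87 st ⊓ L821 st = ⊥ := by
    refine eq_bot_iff.2 fun α hα => ?_
    have h₇ := ((hmem₇ α).1 hα.1).2
    have h₂₁ := ((hmem₂₁ α).1 hα.2).2
    have h : (4 : ℝ) • α = 0 := by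
      rw [show (4 : ℝ) • α = (3 : ℝ) • α - -α by module, ← h₇, ← h₂₁, sub_self]
    exact (smul_eq_zero.1 h).resolve_left (by norm_num)
  have hsup : L87 st ⊔ L821 st = gr8 2 := by
    refine le_antisymm (sup_le inf_le_left inf_le_left) fun α hα => ?_
    have hBB : B8 st (B8 st α) = (2 : ℝ) • B8 st α + (3 : ℝ) • α := by
      rw [← sub_eq_zero, ← hquad α hα]
      abel
    refine Submodule.mem_sup.2 ⟨(1 / 4 : ℝ) • (B8 st α + α), (hmem₇ _).2 ⟨?_, ?_⟩,
      (1 / 4 : ℝ) • ((3 : ℝ) • α - B8 st α), (hmem₂₁ _).2 ⟨?_, ?_⟩, by module⟩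
    · exact Submodule.smul_mem _ _ (add_mem (hBmem α hα) hα)
    · rw [map_smul, map_add, hBB]
      module
    · exact Submodule.smul_mem _ _ (sub_mem (Submodule.smul_mem _ _ hα) (hBmem α hα))
    · rw [map_smul, map_sub, map_smul, hBB]
      module
  have hL87 : L87 st = Submodule.span ℝ (Set.range quadForm) := by
    refine le_antisymm (fun α hα => ?_) (Submodule.span_le.2 (Set.range_subset_iff.2 fun i =>
      (hmem₇ _).2 ⟨sum_mem fun a _ => pairForm_mem _, B8_quadForm hB i⟩))
    obtain ⟨hα, hBα⟩ := (hmem₇ α).1 hα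
    have hle : gr8 2 ≤ (Submodule.span ℝ (Set.range quadForm)).comap (B8 st + LinearMap.id) := by
      rw [← hspan, Submodule.span_le]
      rintro _ ⟨x, rfl⟩
      simpa [hB] using Submodule.subset_span (Set.mem_range_self x.1)
    have h : B8 st α + α ∈ Submodule.span ℝ (Set.range quadForm) := hle hα
    rw [show α = (1 / 4 : ℝ) • (B8 st α + α) by rw [hBα]; module]
    exact Submodule.smul_mem _ _ h
  have hfin₇ : Module.finrank ℝ (L87 st) = 7 := by
    rw [hL87, finrank_span_eq_card (quadForm_linearIndependent hg), Fintype.card_fin]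
  refine ⟨hquad, hinf, hsup, hfin₇, ?_⟩
  have : FiniteDimensional ℝ (L87 st) := Submodule.finiteDimensional_of_le (S₂ := gr8 2) inf_le_left
  have : FiniteDimensional ℝ (L821 st) :=
    Submodule.finiteDimensional_of_le (S₂ := gr8 2) inf_le_left
  have h := Submodule.finrank_sup_add_finrank_inf_eq (L87 st) (L821 st)
  rw [hsup, hinf, finrank_bot, hfin₇, finrank_gr8, show Nat.choose 8 2 = 28 from rfl] at h
  omega
end
end

section
/- Let ∗φ be the Hodge dual of the standard G₂ 3-form on R⁷ and let ξ ∈ (R⁷)* be nonzero. Then the linear map Λ¹(R⁷)* → Λ⁴(R⁷)*, α ↦ (ι_{ξ♯} ∗φ) ∧ α, is injective. -/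
open ExteriorAlgebra

noncomputable section

abbrev W7 := Fin 7 → ℝ
abbrev E7 := ExteriorAlgebra ℝ W7

/-- The standard basis covectors `e^i` (indices `0,…,6` correspond to `1,…,7`). -/
def e7 (i : Fin 7) : E7 := ExteriorAlgebra.ι ℝ (Pi.single i 1)

/-- The wedge monomial `e^{i₁…i_k}` for `{i₁ < ⋯ < i_k} = s`. -/
def mono7 (s : Finset (Fin 7)) : E7 := ((s.sort (· ≤ ·)).map e7).prod

/-- The standard volume form `e^{1…7}`. -/
def vol7 : E7 := mono7 Finset.univ

/-- The space of `k`-forms. -/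
def gr7 (k : ℕ) : Submodule ℝ E7 := ⋀[ℝ]^k W7

/-- The covector `u♭ = g(u,·)` of a vector `u ∈ ℝ⁷` (standard metric). -/
def flat7 (u : W7) : Module.Dual ℝ W7 := ∑ i, u i • (LinearMap.proj i)

/-- Interior multiplication `ι_u` with the vector `u`. -/
def ctr7 (u : W7) : E7 →ₗ[ℝ] E7 := CliffordAlgebra.contractLeft (flat7 u)

/-- The standard G₂ 3-form `φ = e^{123}+e^{145}+e^{167}+e^{246}−e^{257}−e^{347}−e^{356}`. -/
def phi7 : E7 :=
  e7 0 * e7 1 * e7 2 + e7 0 * e7 3 * e7 4 + e7 0 * e7 5 * e7 6 + e7 1 * e7 3 * e7 5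
    - e7 1 * e7 4 * e7 6 - e7 2 * e7 3 * e7 6 - e7 2 * e7 4 * e7 5

/-- `∗φ = e^{4567}+e^{2367}+e^{2345}+e^{1357}−e^{1346}−e^{1256}−e^{1247}`. -/
def psi7 : E7 :=
  e7 3 * e7 4 * e7 5 * e7 6 + e7 1 * e7 2 * e7 5 * e7 6 + e7 1 * e7 2 * e7 3 * e7 4
    + e7 0 * e7 2 * e7 4 * e7 6 - e7 0 * e7 2 * e7 3 * e7 5 - e7 0 * e7 1 * e7 4 * e7 5
    - e7 0 * e7 1 * e7 3 * e7 6

theorem contractLeft_exterior_ι_mul (d : Module.Dual ℝ W7) (a : W7) (b : E7) :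
    CliffordAlgebra.contractLeft d (ι ℝ a * b) =
      d a • b - ι ℝ a * CliffordAlgebra.contractLeft d b :=
  CliffordAlgebra.contractLeft_ι_mul d a b

theorem contractLeft_ι_eq_smul_one (d : Module.Dual ℝ W7) (a : W7) :
    CliffordAlgebra.contractLeft d (ι ℝ a) = d a • (1 : E7) :=
  (CliffordAlgebra.contractLeft_ι _ d a).trans (Algebra.algebraMap_eq_smul_one _)

/-- The evaluation of a 4-form on four vectors, given as functionals on covectors. -/
def eval4 (p q r s : Module.Dual ℝ W7) : E7 →ₗ[ℝ] ℝ :=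
  (algebraMapInv (R := ℝ) (M := W7)).toLinearMap ∘ₗ CliffordAlgebra.contractLeft s ∘ₗ
    CliffordAlgebra.contractLeft r ∘ₗ CliffordAlgebra.contractLeft q ∘ₗ
    CliffordAlgebra.contractLeft p

theorem eval4_mul (p q r s : Module.Dual ℝ W7) (a b c d : W7) :
    eval4 p q r s (ι ℝ a * (ι ℝ b * (ι ℝ c * ι ℝ d))) =
      Matrix.det !![p a, p b, p c, p d; q a, q b, q c, q d;
        r a, r b, r c, r d; s a, s b, s c, s d] := by
  simp [eval4, contractLeft_exterior_ι_mul,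
    Matrix.det_succ_row_zero, Fin.sum_univ_succ, Fin.succAbove]
  ring

theorem eval4_contractLeft_mul (ξ p q r s : Module.Dual ℝ W7) (a b c d v : W7) :
    eval4 p q r s (CliffordAlgebra.contractLeft ξ (ι ℝ a * (ι ℝ b * (ι ℝ c * ι ℝ d))) * ι ℝ v) =
      eval4 ξ p q r (ι ℝ a * (ι ℝ b * (ι ℝ c * ι ℝ d))) * s v
        - eval4 ξ p q s (ι ℝ a * (ι ℝ b * (ι ℝ c * ι ℝ d))) * r v
        + eval4 ξ p r s (ι ℝ a * (ι ℝ b * (ι ℝ c * ι ℝ d))) * q v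
        - eval4 ξ q r s (ι ℝ a * (ι ℝ b * (ι ℝ c * ι ℝ d))) * p v := by
  simp only [contractLeft_exterior_ι_mul, contractLeft_ι_eq_smul_one, mul_sub, sub_mul, smul_mul_assoc,
    mul_smul_comm, mul_one, mul_assoc, map_sub, map_smul, eval4_mul]
  simp [Matrix.det_succ_row_zero, Fin.sum_univ_succ, Fin.succAbove]
  ring

theorem eval4_contractLeft_psi7_mul (ξ p q r s : Module.Dual ℝ W7) (v : W7) :
    eval4 p q r s (CliffordAlgebra.contractLeft ξ psi7 * ι ℝ v) =
      eval4 ξ p q r psi7 * s v - eval4 ξ p q s psi7 * r v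
        + eval4 ξ p r s psi7 * q v - eval4 ξ q r s psi7 * p v := by
  simp only [psi7, e7, mul_assoc, map_add, map_sub, add_mul, sub_mul, eval4_contractLeft_mul]
  ring

/-- The components of the 3-form `ι_{ξ♯} ∗φ`. -/
def psiComp (ξ : Module.Dual ℝ W7) (i j k : Fin 7) : ℝ :=
  eval4 ξ (LinearMap.proj i) (LinearMap.proj j) (LinearMap.proj k) psi7

theorem psiComp_eq (ξ : Module.Dual ℝ W7) (i j k : Fin 7) :
    psiComp ξ i j k =
      let δ (a b : Fin 7) : ℝ := if a = b then 1 else 0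
      let m (a b c : Fin 7) : ℝ := δ a i * (δ b j * δ c k - δ c j * δ b k)
        - δ b i * (δ a j * δ c k - δ c j * δ a k) + δ c i * (δ a j * δ b k - δ b j * δ a k)
      let x (a : Fin 7) : ℝ := ξ (Pi.single a 1)
      let q (a b c d : Fin 7) : ℝ :=
        x a * m b c d - x b * m a c d + x c * m a b d - x d * m a b c
      q 3 4 5 6 + q 1 2 5 6 + q 1 2 3 4 + q 0 2 4 6 - q 0 2 3 5 - q 0 1 4 5 - q 0 1 3 6 := by
  extract_lets δ m x q
  have hδ (a i : Fin 7) : (Pi.single a (1 : ℝ) : W7) i = δ a i := by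
    simp [δ, Pi.single_apply, eq_comm]
  have hq (a b c d : Fin 7) :
      q a b c d = Matrix.det !![x a, x b, x c, x d; δ a i, δ b i, δ c i, δ d i;
        δ a j, δ b j, δ c j, δ d j; δ a k, δ b k, δ c k, δ d k] := by
    simp [q, m, Matrix.det_succ_row_zero, Fin.sum_univ_succ, Fin.succAbove]
    ring
  simp only [psiComp, psi7, e7, mul_assoc, map_add, map_sub, eval4_mul, LinearMap.proj_apply,
    hδ, hq, x]

/-- The components of the 4-form `(ι_{ξ♯} ∗φ) ∧ v`. -/
def wedgeComp (ξ : Module.Dual ℝ W7) (v : W7) (i j k l : Fin 7) : ℝ :=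
  psiComp ξ i j k * v l - psiComp ξ i j l * v k + psiComp ξ i k l * v j - psiComp ξ j k l * v i

set_option maxHeartbeats 4000000 in
set_option maxRecDepth 10000 in
/-- `|(ι_{ξ♯} ∗φ) ∧ v|² = 2 (|ξ|² |v|² + ⟨ξ, v⟩²)`. -/
theorem sum_sq_wedgeComp (ξ : Module.Dual ℝ W7) (v : W7) :
    ∑ i, ∑ j, ∑ k, ∑ l, (if i < j ∧ j < k ∧ k < l then wedgeComp ξ v i j k l ^ 2 else 0) =
      2 * ((∑ i, ξ (Pi.single i 1) ^ 2) * (∑ i, v i ^ 2) +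
        (∑ i, ξ (Pi.single i 1) * v i) ^ 2) := by
  simp only [Fin.sum_univ_seven]
  simp only [Fin.reduceLT, and_true, and_false, if_true, if_false, add_zero, zero_add]
  simp [wedgeComp, psiComp_eq]
  ring

theorem eq_zero_of_contractLeft_psi7_mul_ι_eq_zero (ξ : Module.Dual ℝ W7) (hξ : ξ ≠ 0) (v : W7)
    (h : CliffordAlgebra.contractLeft ξ psi7 * ι ℝ v = 0) : v = 0 := by
  have hw (i j k l : Fin 7) : wedgeComp ξ v i j k l = 0 := by
    have := eval4_contractLeft_psi7_mul ξ (LinearMap.proj i) (LinearMap.proj j)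
      (LinearMap.proj k) (LinearMap.proj l) v
    rw [h, map_zero] at this
    exact this.symm
  have hs := sum_sq_wedgeComp ξ v
  simp only [hw, ne_eq, OfNat.ofNat_ne_zero, not_false_eq_true, zero_pow, ite_self,
    Finset.sum_const_zero] at hs
  obtain ⟨m, hm⟩ : ∃ m, ξ (Pi.single m 1) ≠ 0 := by
    by_contra! hc
    exact hξ ((Pi.basisFun ℝ (Fin 7)).ext fun i => by simpa using hc i)
  have hx : 0 < ∑ i, ξ (Pi.single i 1) ^ 2 :=
    Finset.sum_pos' (fun i _ => sq_nonneg _) ⟨m, Finset.mem_univ m, by positivity⟩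
  have hv : 0 ≤ ∑ i, v i ^ 2 := Finset.sum_nonneg fun i _ => sq_nonneg _
  have hv0 : ∑ i, v i ^ 2 = 0 := by
    refine (mul_eq_zero.mp (le_antisymm ?_ (mul_nonneg hx.le hv))).resolve_left hx.ne'
    linarith [sq_nonneg (∑ i, ξ (Pi.single i 1) * v i)]
  ext i
  have := (Finset.sum_eq_zero_iff_of_nonneg fun i _ => sq_nonneg (v i)).mp hv0 i (Finset.mem_univ i)
  simpa using this

/-- for every nonzero covector `ξ`, the map
`Λ¹ → Λ⁴, α ↦ (ι_{ξ♯} ∗φ) ∧ α` is injective. -/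
theorem stmt13 (ξ : Module.Dual ℝ W7) (hξ : ξ ≠ 0) :
    Set.InjOn (fun α : E7 => CliffordAlgebra.contractLeft ξ psi7 * α) (gr7 1) := by
  intro α hα β hβ h
  simp only [SetLike.mem_coe, gr7, exteriorPower, pow_one, LinearMap.mem_range] at hα hβ
  obtain ⟨a, rfl⟩ := hα
  obtain ⟨b, rfl⟩ := hβ
  have hab : a - b = 0 := eq_zero_of_contractLeft_psi7_mul_ι_eq_zero ξ hξ _ (by
    rw [map_sub, mul_sub]
    exact sub_eq_zero.mpr h)
  rw [sub_eq_zero.mp hab]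
end
end
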